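/- arXiv:1510.00588 — 2 statements merged into one kernel-verified Lean document; each statement's English description precedes it below -/
import Mathlib

section
/- Let P be an r-differential poset and R a commutative ring with identity of characteristic 0. Then for every n ≥ 0, DU_n − UD_n = r·I as operators on RP_n, where I is the identity. -/
open Polynomial

/-- A rectangular matrix over a commutative ring has Smith normal form: there are
invertible matrices `P`, `Q` such that `P * A * Q` is diagonal with diagonal entries
forming a divisibility chain. -/
def Matrix.HasSNF {R : Type*} [CommRing R] {m n : ℕ} (A : Matrix (Fin m) (Fin n) R) : Prop :=
  ∃ (P : Matrix (Fin m) (Fin m) R) (Q : Matrix (Fin n) (Fin n) R),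
    IsUnit P ∧ IsUnit Q ∧
    (∀ (i : Fin m) (j : Fin n), (i : ℕ) ≠ (j : ℕ) → (P * A * Q) i j = 0) ∧
    (∀ (i : ℕ) (h₁ : i + 1 < m) (h₂ : i + 1 < n),
      (P * A * Q) ⟨i, Nat.lt_of_succ_lt h₁⟩ ⟨i, Nat.lt_of_succ_lt h₂⟩ ∣
        (P * A * Q) ⟨i + 1, h₁⟩ ⟨i + 1, h₂⟩)

/-- SNF for matrices with arbitrary finite index types. -/
def Matrix.HasSNF' {ι κ R : Type*} [Fintype ι] [Fintype κ] [CommRing R]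
    (A : Matrix ι κ R) : Prop :=
  ∃ (eι : ι ≃ Fin (Fintype.card ι)) (eκ : κ ≃ Fin (Fintype.card κ)),
    Matrix.HasSNF (Matrix.reindex eι eκ A)
/-- An endomorphism `φ` of a `ℤ`-module `M` (equivalently, the `ℤ[x]`-module `(M, φ)` where
`x` acts as `φ`) has rational canonical form over `ℤ`: `M` is an internal direct sum of
cyclic `ℤ[x]`-submodules whose annihilators are generated by monic non-constant polynomials
`a_1 ∣ a_2 ∣ ... ∣ a_k`. -/
def Module.End.HasRCF {M : Type*} [AddCommGroup M] [Module ℤ M] (φ : Module.End ℤ M) : Prop :=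
  ∃ (k : ℕ) (V : Fin k → Submodule ℤ[X] (Module.AEval' φ)) (a : Fin k → ℤ[X]),
    (∀ i, (a i).Monic) ∧ (∀ i, 0 < (a i).natDegree) ∧
    (∀ i j : Fin k, i ≤ j → a i ∣ a j) ∧
    (∀ i, ∃ v : Module.AEval' φ, V i = Submodule.span ℤ[X] {v}) ∧
    (∀ i, (V i).annihilator = Ideal.span {a i}) ∧
    DirectSum.IsInternal V
/-- An `r`-differential poset. -/
structure DiffPoset (r : ℕ) where
  P : Type
  [po : PartialOrder P]
  locallyFinite : ∀ x y : P, (Set.Icc x y).Finite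
  rk : P → ℕ
  fiberFinite : ∀ n : ℕ, {x : P | rk x = n}.Finite
  bot : P
  bot_le : ∀ x : P, bot ≤ x
  rk_bot : rk bot = 0
  rk_covBy : ∀ {x y : P}, x ⋖ y → rk y = rk x + 1
  d2 : ∀ {x y : P}, x ≠ y →
      {z : P | z ⋖ x ∧ z ⋖ y}.ncard = {z : P | x ⋖ z ∧ y ⋖ z}.ncard
  d3 : ∀ x : P, {z : P | x ⋖ z}.ncard = {z : P | z ⋖ x}.ncard + r

attribute [instance] DiffPoset.po

namespace DiffPoset

variable {r : ℕ} (D : DiffPoset r)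

/-- The `n`-th rank `P_n` of the poset. -/
abbrev level (n : ℕ) : Type := {x : D.P // D.rk x = n}

noncomputable instance (n : ℕ) : Fintype (D.level n) := (D.fiberFinite n).fintype

noncomputable instance (n : ℕ) : DecidableEq (D.level n) := Classical.decEq _

noncomputable instance (x y : D.P) : Decidable (x ⋖ y) := Classical.dec _

/-- The rank size `p_n`. -/
noncomputable def p (n : ℕ) : ℕ := Fintype.card (D.level n)

/-- The matrix of the up map `U_n` in the standard basis. -/
noncomputable def upMatrix (R : Type*) [CommRing R] (n : ℕ) :
    Matrix (D.level (n + 1)) (D.level n) R :=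
  fun y x => if (x : D.P) ⋖ (y : D.P) then 1 else 0

/-- The matrix of the down map `D_{n+1}` in the standard basis. -/
noncomputable def downMatrix (R : Type*) [CommRing R] (n : ℕ) :
    Matrix (D.level n) (D.level (n + 1)) R :=
  fun y x => if (y : D.P) ⋖ (x : D.P) then 1 else 0

/-- The up map `U_n : RP_n → RP_{n+1}`. -/
noncomputable def up (R : Type*) [CommRing R] (n : ℕ) :
    (D.level n → R) →ₗ[R] (D.level (n + 1) → R) :=
  (D.upMatrix R n).mulVecLin

/-- The down map `D_{n+1} : RP_{n+1} → RP_n`. -/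
noncomputable def down (R : Type*) [CommRing R] (n : ℕ) :
    (D.level (n + 1) → R) →ₗ[R] (D.level n → R) :=
  (D.downMatrix R n).mulVecLin

/-- The operator `DU_n = D_{n+1} ∘ U_n`. -/
noncomputable def du (R : Type*) [CommRing R] (n : ℕ) :
    Module.End R (D.level n → R) :=
  (D.down R n) ∘ₗ (D.up R n)

/-- The matrix `[DU_n]` in the standard basis. -/
noncomputable def duMatrix (R : Type*) [CommRing R] (n : ℕ) :
    Matrix (D.level n) (D.level n) R :=
  D.downMatrix R n * D.upMatrix R n

/-- The operator `UD_n = U_{n-1} ∘ D_n` (zero for `n = 0`). -/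
noncomputable def ud (R : Type*) [CommRing R] : (n : ℕ) → Module.End R (D.level n → R)
  | 0 => 0
  | (n + 1) => (D.up R n) ∘ₗ (D.down R n)

/-- The matrix `[UD_n]` in the standard basis (zero for `n = 0`). -/
noncomputable def udMatrix (R : Type*) [CommRing R] :
    (n : ℕ) → Matrix (D.level n) (D.level n) R
  | 0 => 0
  | (n + 1) => D.upMatrix R n * D.downMatrix R n

/-- The rank size difference `Δp_n = p_n - p_{n-1}` (with `p_{-1} = 0`), as an integer. -/
noncomputable def dp : ℕ → ℤ
  | 0 => (D.p 0 : ℤ)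
  | (n + 1) => (D.p (n + 1) : ℤ) - (D.p n : ℤ)

/-- The rank size difference `Δp_n = p_n - p_{n-1}` (with `p_{-1} = 0`), as a natural number. -/
noncomputable def dpN : ℕ → ℕ
  | 0 => D.p 0
  | (n + 1) => D.p (n + 1) - D.p n

end DiffPoset

namespace DiffPoset

variable {r : ℕ} (D : DiffPoset r)

/-- Counting the elements of `P_m` satisfying a predicate supported on `P_m`. -/
lemma sum_level_ite (R : Type*) [CommRing R] (m : ℕ) (q : D.P → Prop) [DecidablePred q]
    (hq : ∀ z, q z → D.rk z = m) :
    ∑ z : D.level m, (if q z then (1 : R) else 0) = ({z : D.P | q z}.ncard : R) := by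
  have himage : {z : D.P | q z} = Subtype.val '' {z : D.level m | q z} := by
    ext z
    constructor
    · exact fun hz => ⟨⟨z, hq z hz⟩, hz, rfl⟩
    · rintro ⟨w, hw, rfl⟩
      exact hw
  rw [Finset.sum_boole, himage, Set.ncard_image_of_injective _ Subtype.val_injective,
    Set.ncard_eq_toFinset_card', Set.toFinset_ofPred]

lemma duMatrix_apply (R : Type*) [CommRing R] (n : ℕ) (x y : D.level n) :
    D.duMatrix R n x y = ({z : D.P | (x : D.P) ⋖ z ∧ (y : D.P) ⋖ z}.ncard : R) := by
  classical
  rw [← D.sum_level_ite R (n + 1) _ fun z hz => by rw [D.rk_covBy hz.1, x.2]]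
  simp only [duMatrix, Matrix.mul_apply, downMatrix, upMatrix, ite_and, ite_mul, one_mul,
    zero_mul]

lemma udMatrix_apply (R : Type*) [CommRing R] (n : ℕ) (x y : D.level n) :
    D.udMatrix R n x y = ({z : D.P | z ⋖ (x : D.P) ∧ z ⋖ (y : D.P)}.ncard : R) := by
  classical
  cases n with
  | zero =>
    have hempty : {z : D.P | z ⋖ (x : D.P) ∧ z ⋖ (y : D.P)} = ∅ := by
      ext z
      simp only [Set.mem_ofPred_eq, Set.mem_empty_iff_false, iff_false]
      intro hz
      have h := D.rk_covBy hz.1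
      have hx := x.2
      omega
    simp [udMatrix, hempty]
  | succ n =>
    rw [← D.sum_level_ite R n _ fun z hz => by
      have h := D.rk_covBy hz.1
      have hx := x.2
      omega]
    simp only [udMatrix, Matrix.mul_apply, downMatrix, upMatrix, ite_and, ite_mul, one_mul,
      zero_mul]

lemma duMatrix_eq (R : Type*) [CommRing R] (n : ℕ) :
    D.duMatrix R n = D.udMatrix R n + (r : R) • 1 := by
  ext x y
  rw [Matrix.add_apply, Matrix.smul_apply, duMatrix_apply, udMatrix_apply]
  by_cases hxy : x = y
  · subst hxy
    simp [D.d3 x]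
  · rw [D.d2 (Subtype.val_injective.ne hxy)]
    simp [hxy]

lemma du_eq_mulVecLin (R : Type*) [CommRing R] (n : ℕ) :
    D.du R n = (D.duMatrix R n).mulVecLin :=
  (Matrix.mulVecLin_mul _ _).symm

lemma ud_eq_mulVecLin (R : Type*) [CommRing R] (n : ℕ) :
    D.ud R n = (D.udMatrix R n).mulVecLin := by
  cases n with
  | zero => exact Matrix.mulVecLin_zero.symm
  | succ n => exact (Matrix.mulVecLin_mul _ _).symm

end DiffPoset

/-- For an `r`-differential poset and a commutative ring `R` with identity
of characteristic `0`, `DU_n − UD_n = r·I` on `RP_n` for every `n ≥ 0`. -/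
theorem du_sub_ud_eq_smul_id {r : ℕ} (hr : 0 < r) (D : DiffPoset r)
    (R : Type*) [CommRing R] [CharZero R] (n : ℕ) :
    D.du R n - D.ud R n = (r : R) • (1 : Module.End R (D.level n → R)) := by
  rw [D.du_eq_mulVecLin, D.ud_eq_mulVecLin, D.duMatrix_eq, Matrix.mulVecLin_add,
    add_sub_cancel_left]
  refine LinearMap.ext fun v => ?_
  simp
end

section
/- Let P be an r-differential poset and Q an s-differential poset with rank sizes p_n and q_n, and let pq_n denote the rank sizes of the Cartesian product poset P × Q (with componentwise order). Then pq_n = Σ_{i=0}^{n} q_{n−i} p_i for all n ≥ 0, and if Δq_n ≥ Δq_{n−1} for all n ≥ 2 (where Δq_n := q_n − q_{n−1}), then Δpq_n − Δpq_{n−1} ≥ 1 for all n ≥ 2 (where Δpq_n := pq_n − pq_{n−1}). -/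
open Polynomial

namespace DiffPoset

variable {r : ℕ} (D : DiffPoset r)

theorem exists_covBy_of_bot_lt {x : D.P} (hx : D.bot < x) : ∃ z, z ⋖ x := by
  have hfin : (Set.Ico D.bot x).Finite := (D.locallyFinite D.bot x).subset Set.Ico_subset_Icc_self
  obtain ⟨z, hz⟩ := hfin.exists_maximal ⟨D.bot, le_rfl, hx⟩
  refine ⟨z, hz.prop.2, fun w hzw hwx => ?_⟩
  exact hzw.not_ge (hz.le_of_ge ⟨D.bot_le w, hwx⟩ hzw.le)

theorem eq_bot_of_rk_eq_zero {x : D.P} (hx : D.rk x = 0) : x = D.bot := by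
  by_contra h
  obtain ⟨z, hz⟩ := D.exists_covBy_of_bot_lt (lt_of_le_of_ne (D.bot_le x) (Ne.symm h))
  have := D.rk_covBy hz
  omega

theorem p_eq_ncard (n : ℕ) : D.p n = {x : D.P | D.rk x = n}.ncard := by
  rw [p, ← Nat.card_eq_fintype_card]
  rfl

theorem p_zero : D.p 0 = 1 := by
  rw [p_eq_ncard, Set.ncard_eq_one]
  refine ⟨D.bot, Set.ext fun x => ⟨D.eq_bot_of_rk_eq_zero, ?_⟩⟩
  rintro rfl
  exact D.rk_bot

theorem ncard_covBy_add_le_p (x : D.P) :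
    {z : D.P | z ⋖ x}.ncard + r ≤ D.p (D.rk x + 1) := by
  rw [← D.d3, p_eq_ncard]
  exact Set.ncard_le_ncard (fun z hz => D.rk_covBy hz) (D.fiberFinite _)

theorem p_pos (hr : 0 < r) : ∀ n, 0 < D.p n
  | 0 => by simp [p_zero]
  | n + 1 => by
    have h := p_pos hr n
    rw [p, Fintype.card_pos_iff] at h
    obtain ⟨x, rfl⟩ := h
    have := D.ncard_covBy_add_le_p x
    omega

theorem two_le_p_two (hr : 0 < r) : 2 ≤ D.p 2 := by
  have h := D.p_pos hr 1
  rw [p, Fintype.card_pos_iff] at h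
  obtain ⟨x, hx⟩ := h
  have hlt : D.bot < x := by
    refine lt_of_le_of_ne (D.bot_le x) ?_
    rintro rfl
    simp [D.rk_bot] at hx
  obtain ⟨z, hz⟩ := D.exists_covBy_of_bot_lt hlt
  have hfin : {z : D.P | z ⋖ x}.Finite :=
    (D.locallyFinite D.bot x).subset fun w hw => ⟨D.bot_le w, hw.le⟩
  have hpos : 0 < {z : D.P | z ⋖ x}.ncard := (Set.ncard_pos hfin).2 ⟨z, hz⟩
  have := D.ncard_covBy_add_le_p x
  rw [hx, one_add_one_eq_two] at this
  omega

theorem sum_level_indicator {R : Type*} [CommRing R] (n : ℕ) (q : D.P → Prop) [DecidablePred q]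
    (hq : ∀ z, q z → D.rk z = n) :
    ∑ y : D.level n, (if q y then 1 else 0 : R) = ({z : D.P | q z}.ncard : R) := by
  rw [Finset.sum_boole]
  congr 1
  rw [← Set.ncard_coe_finset, ← Set.ncard_image_of_injective _ Subtype.val_injective]
  congr 1
  ext z
  simpa using hq z

theorem transpose_upMatrix (R : Type*) [CommRing R] (n : ℕ) :
    (D.upMatrix R n).transpose = D.downMatrix R n := rfl

/-- The commutation relation `DU - UD = r`. -/
theorem duMatrix_succ (R : Type*) [CommRing R] (n : ℕ) :
    D.duMatrix R (n + 1) = D.udMatrix R (n + 1) + (r : R) • 1 := by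
  classical
  ext x y
  have hdu : D.duMatrix R (n + 1) x y = ({z : D.P | x.1 ⋖ z ∧ y.1 ⋖ z}.ncard : R) := by
    rw [← D.sum_level_indicator (n + 1 + 1) (fun z => x.1 ⋖ z ∧ y.1 ⋖ z)
      fun z hz => by rw [D.rk_covBy hz.1, x.2]]
    simp only [duMatrix, Matrix.mul_apply, downMatrix, upMatrix, ite_and, ite_mul, one_mul,
      zero_mul]
  have hud : D.udMatrix R (n + 1) x y = ({z : D.P | z ⋖ x.1 ∧ z ⋖ y.1}.ncard : R) := by
    rw [← D.sum_level_indicator n (fun z => z ⋖ x.1 ∧ z ⋖ y.1)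
      fun z hz => by have := D.rk_covBy hz.1; have := x.2; omega]
    simp only [udMatrix, Matrix.mul_apply, downMatrix, upMatrix, ite_and, ite_mul, one_mul,
      zero_mul]
  rw [Matrix.add_apply, hdu, hud, Matrix.smul_apply, Matrix.one_apply]
  rcases eq_or_ne x y with rfl | hxy
  · simp [D.d3]
  · simp [hxy, D.d2 fun h => hxy (Subtype.ext h)]

theorem up_injective (hr : 0 < r) (n : ℕ) : Function.Injective (D.up ℚ (n + 1)) := by
  rw [injective_iff_map_eq_zero]
  intro v hv
  have hv' : (D.upMatrix ℚ (n + 1)).mulVec v = 0 := hv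
  have h : v ⬝ᵥ (D.duMatrix ℚ (n + 1)).mulVec v = 0 := by
    rw [duMatrix, ← Matrix.mulVec_mulVec, hv', Matrix.mulVec_zero, dotProduct_zero]
  have hud : v ⬝ᵥ (D.udMatrix ℚ (n + 1)).mulVec v =
      (D.downMatrix ℚ n).mulVec v ⬝ᵥ (D.downMatrix ℚ n).mulVec v := by
    rw [udMatrix, ← Matrix.mulVec_mulVec, Matrix.dotProduct_mulVec, ← Matrix.mulVec_transpose,
      transpose_upMatrix]
  rw [duMatrix_succ, Matrix.add_mulVec, dotProduct_add, hud, Matrix.smul_mulVec,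
    Matrix.one_mulVec, dotProduct_smul, smul_eq_mul] at h
  have h₁ : 0 ≤ (D.downMatrix ℚ n).mulVec v ⬝ᵥ (D.downMatrix ℚ n).mulVec v :=
    Finset.sum_nonneg fun i _ => mul_self_nonneg _
  have h₂ : 0 ≤ v ⬝ᵥ v := Finset.sum_nonneg fun i _ => mul_self_nonneg _
  have hr' : (0 : ℚ) < r := by exact_mod_cast hr
  have h₃ : v ⬝ᵥ v = 0 := by nlinarith
  exact dotProduct_self_eq_zero.1 h₃

theorem p_succ_le (hr : 0 < r) (n : ℕ) : D.p (n + 1) ≤ D.p (n + 2) := by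
  simpa [p] using LinearMap.finrank_le_finrank_of_injective (D.up_injective hr n)

theorem card_prod_rk_eq {s : ℕ} (E : DiffPoset s) (n : ℕ) :
    Nat.card {x : D.P × E.P // D.rk x.1 + E.rk x.2 = n} =
      ∑ i ∈ Finset.range (n + 1), E.p (n - i) * D.p i := by
  let e : {x : D.P × E.P // D.rk x.1 + E.rk x.2 = n} ≃
      (k : Finset.HasAntidiagonal.antidiagonal n) × (D.level k.1.1 × E.level k.1.2) :=
    { toFun := fun x => ⟨⟨(D.rk x.1.1, E.rk x.1.2), by simpa using x.2⟩,
        ⟨x.1.1, rfl⟩, ⟨x.1.2, rfl⟩⟩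
      invFun := fun y => ⟨(y.2.1.1, y.2.2.1), by
        rw [y.2.1.2, y.2.2.2]
        exact Finset.HasAntidiagonal.mem_antidiagonal.1 y.1.2⟩
      left_inv := fun _ => rfl
      right_inv := by
        rintro ⟨⟨⟨i, j⟩, hk⟩, ⟨a, ha⟩, ⟨b, hb⟩⟩
        dsimp only at ha hb
        subst ha hb
        rfl }
  rw [Nat.card_congr e, Nat.card_eq_fintype_card, Fintype.card_sigma]
  simp only [Fintype.card_prod]
  rw [Finset.sum_coe_sort (Finset.HasAntidiagonal.antidiagonal n)
    fun k => Fintype.card (D.level k.1) * Fintype.card (E.level k.2),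
    Finset.Nat.sum_antidiagonal_eq_sum_range_succ_mk]
  exact Finset.sum_congr rfl fun i _ => mul_comm _ _

end DiffPoset

/-- For an `r`-differential poset `P` and an `s`-differential poset `Q`,
the rank sizes of `P × Q` satisfy `pq_n = Σ_{i=0}^{n} q_{n−i} p_i`; and if
`Δq_n ≥ Δq_{n−1}` for all `n ≥ 2` then `Δpq_n − Δpq_{n−1} ≥ 1` for all `n ≥ 2`. -/
theorem prod_rank_sizes {r s : ℕ} (hr : 0 < r) (hs : 0 < s)
    (D : DiffPoset r) (E : DiffPoset s) :
    let pq : ℕ → ℕ := fun n => Nat.card {x : D.P × E.P // D.rk x.1 + E.rk x.2 = n}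
    (∀ n : ℕ, pq n = ∑ i ∈ Finset.range (n + 1), E.p (n - i) * D.p i) ∧
    ((∀ n : ℕ, 2 ≤ n → (E.p (n - 1) : ℤ) - E.p (n - 2) ≤ (E.p n : ℤ) - E.p (n - 1)) →
      ∀ n : ℕ, 2 ≤ n →
        1 ≤ ((pq n : ℤ) - pq (n - 1)) - ((pq (n - 1) : ℤ) - pq (n - 2))) := by
  intro pq
  have hpq : ∀ n : ℕ, pq n = ∑ i ∈ Finset.range (n + 1), E.p (n - i) * D.p i :=
    D.card_prod_rk_eq E
  refine ⟨hpq, fun hconv n hn => ?_⟩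
  obtain ⟨m, rfl⟩ := Nat.exists_eq_add_of_le' hn
  have hsecond : ((pq (m + 2) : ℤ) - pq (m + 1)) - ((pq (m + 1) : ℤ) - pq m) =
      ∑ i ∈ Finset.range (m + 1),
        ((E.p (m + 2 - i) : ℤ) - 2 * E.p (m + 1 - i) + E.p (m - i)) * D.p i +
      ((E.p 1 : ℤ) - 2) * D.p (m + 1) + D.p (m + 2) := by
    have h₂ : (pq (m + 2) : ℤ) = ∑ i ∈ Finset.range (m + 1), (E.p (m + 2 - i) : ℤ) * D.p i +
        E.p 1 * D.p (m + 1) + D.p (m + 2) := by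
      rw [hpq, Finset.sum_range_succ, Finset.sum_range_succ, show m + 2 - (m + 1) = 1 by omega,
        Nat.sub_self, E.p_zero]
      push_cast
      ring
    have h₁ : (pq (m + 1) : ℤ) = ∑ i ∈ Finset.range (m + 1), (E.p (m + 1 - i) : ℤ) * D.p i +
        D.p (m + 1) := by
      rw [hpq, Finset.sum_range_succ, Nat.sub_self, E.p_zero]
      push_cast
      ring
    have h₀ : (pq m : ℤ) = ∑ i ∈ Finset.range (m + 1), (E.p (m - i) : ℤ) * D.p i := by
      rw [hpq]
      push_cast
      rfl
    rw [h₂, h₁, h₀]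
    simp only [add_mul, sub_mul, Finset.sum_add_distrib, Finset.sum_sub_distrib, mul_assoc,
      ← Finset.mul_sum]
    ring
  have hterm : ∀ i ∈ Finset.range (m + 1),
      0 ≤ ((E.p (m + 2 - i) : ℤ) - 2 * E.p (m + 1 - i) + E.p (m - i)) * D.p i := by
    intro i hi
    have hi' := Finset.mem_range.1 hi
    have h := hconv (m + 2 - i) (by omega)
    rw [show m + 2 - i - 1 = m + 1 - i by omega, show m + 2 - i - 2 = m - i by omega] at h
    exact mul_nonneg (by linarith) (Nat.cast_nonneg _)
  have hlast := Finset.single_le_sum hterm (Finset.self_mem_range_succ m)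
  rw [show m + 2 - m = 2 by omega, show m + 1 - m = 1 by omega, Nat.sub_self, E.p_zero] at hlast
  have hsum := Finset.sum_nonneg hterm
  have hmono : (D.p (m + 1) : ℤ) ≤ D.p (m + 2) := by exact_mod_cast D.p_succ_le hr m
  have hpos : ∀ k, (1 : ℤ) ≤ D.p k := fun k => by exact_mod_cast D.p_pos hr k
  have hE₁ : (1 : ℤ) ≤ E.p 1 := by exact_mod_cast E.p_pos hs 1
  have hE₂ : (2 : ℤ) ≤ E.p 2 := by exact_mod_cast E.two_le_p_two hs
  simp only [show m + 2 - 1 = m + 1 by omega, show m + 2 - 2 = m by omega]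
  rw [hsecond]
  rcases hE₁.eq_or_lt with h | h
  · rw [← h] at hlast ⊢
    push_cast at hlast
    nlinarith [hpos m]
  · nlinarith [hpos (m + 1), hpos (m + 2)]
end
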